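/- For any subset S ⊆ [n−1], the statistics inv and imaj are equidistributed on the set of permutations π ∈ S_n with Des(π) = S exactly: Σ_{π : Des(π) = S} q^{inv(π)} = Σ_{π : Des(π) = S} q^{imaj(π)}. -/

import Mathlib

open Polynomial

/-- The number of inversions of a word. -/
def inv {n : ℕ} {β : Type*} [LinearOrder β] (w : Fin n → β) : ℕ :=
  (Finset.univ.filter (fun p : Fin n × Fin n => p.1 < p.2 ∧ w p.2 < w p.1)).card

/-- The major index of a word (sum of 1-based descent positions). -/
def maj {n : ℕ} {β : Type*} [LinearOrder β] (w : Fin n → β) : ℕ :=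
  ∑ p ∈ Finset.univ.filter
      (fun p : Fin n × Fin n => (p.2 : ℕ) = (p.1 : ℕ) + 1 ∧ w p.2 < w p.1),
    ((p.1 : ℕ) + 1)

/-- The descent set of a permutation, as a set of 1-based positions. -/
def DesSet {n : ℕ} (π : Equiv.Perm (Fin n)) : Finset ℕ :=
  (Finset.univ.filter
      (fun p : Fin n × Fin n => (p.2 : ℕ) = (p.1 : ℕ) + 1 ∧ π p.2 < π p.1)).image
    (fun p => (p.1 : ℕ) + 1)


def invL : List ℕ → ℕ
  | [] => 0
  | x :: l => invL l + l.countP (fun y => decide (x < y))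

def topL (x : ℕ) : List ℕ → ℕ
  | [] => 0
  | y :: l => if x < y then (y :: l).length else 0

def majL : List ℕ → ℕ
  | [] => 0
  | x :: l => majL l + topL x l

/-- number of letters at least `y` -/
def geC (s : Multiset ℕ) (y : ℕ) : ℕ := s.countP (fun z => y ≤ z)

noncomputable def qn (k : ℕ) : ℤ[X] := ∑ i ∈ Finset.range k, X ^ i

noncomputable def qf (k : ℕ) : ℤ[X] := ∏ i ∈ Finset.range k, qn (i + 1)

theorem qn_mul (k : ℕ) : qn k * (X - 1) = X ^ k - 1 := geom_sum_mul _ _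

theorem qn_ne (k : ℕ) : qn (k + 1) ≠ 0 := by
  intro h
  have := congrArg (Polynomial.eval 1) h
  simp [qn, Polynomial.eval_finsetSum] at this
  norm_cast at this

theorem qf_ne (k : ℕ) : qf k ≠ 0 := Finset.prod_ne_zero_iff.2 fun i _ => qn_ne i

theorem qf_succ (k : ℕ) : qf (k + 1) = qn (k + 1) * qf k := by
  rw [qf, Finset.prod_range_succ, mul_comm]; rfl

noncomputable def DD (N : ℕ) (s : Multiset ℕ) : ℤ[X] := ∏ x ∈ Finset.range N, qf (s.count x)

theorem DD_ne (N : ℕ) (s : Multiset ℕ) : DD N s ≠ 0 :=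
  Finset.prod_ne_zero_iff.2 fun _ _ => qf_ne _

theorem DD_erase (N : ℕ) (s : Multiset ℕ) (y : ℕ) (hy : y < N) (hs : y ∈ s) :
    DD N s = qn (s.count y) * DD N (s.erase y) := by
  unfold DD
  rw [← Finset.mul_prod_erase _ _ (Finset.mem_range.2 hy),
    ← Finset.mul_prod_erase (Finset.range N) (fun x => qf ((s.erase y).count x)) (Finset.mem_range.2 hy), ← mul_assoc]
  congr 1
  · obtain ⟨k, hk⟩ := Nat.exists_eq_succ_of_ne_zero (Multiset.count_pos.2 hs).ne'
    rw [Multiset.count_erase_self, hk, Nat.succ_eq_add_one, qf_succ]; rfl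
  · refine Finset.prod_congr rfl fun x hx => ?_
    rw [Multiset.count_erase_of_ne (Finset.ne_of_mem_erase hx)]

theorem geC_succ (s : Multiset ℕ) (y : ℕ) : geC s y = geC s (y + 1) + s.count y := by
  unfold geC
  induction s using Multiset.induction_on with
  | empty => simp
  | cons a s ih =>
    simp only [Multiset.countP_cons, Multiset.count_cons, ih]
    split_ifs <;> omega

theorem geC_zero (s : Multiset ℕ) : geC s 0 = s.card := by simp [geC]

theorem geC_top (s : Multiset ℕ) (N : ℕ) (h : ∀ y ∈ s, y < N) : geC s N = 0 := by
  simp only [geC, Multiset.countP_eq_zero]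
  intro a ha; have := h a ha; omega

theorem geC_erase (s : Multiset ℕ) (y : ℕ) : geC (s.erase y) (y + 1) = geC s (y + 1) := by
  by_cases h : y ∈ s
  · conv_rhs => rw [← Multiset.cons_erase h]
    simp [geC]
  · rw [Multiset.erase_of_notMem h]

theorem key_aux (s : Multiset ℕ) (x : ℕ) (P : ℤ[X]) (k : ℕ) :
    ∑ y ∈ Finset.range (x + 1 + k), (if x < y then P else 1) *
      (X ^ geC s (y + 1) * (X ^ s.count y - 1) : ℤ[X]) =
    X ^ s.card - X ^ geC s (x + 1) + P * (X ^ geC s (x + 1) - X ^ geC s (x + 1 + k)) := by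
  have hg : ∀ y, (X ^ geC s (y + 1) * (X ^ s.count y - 1) : ℤ[X]) =
      X ^ geC s y - X ^ geC s (y + 1) := by
    intro y; rw [geC_succ s y, pow_add]; ring
  simp only [hg]
  induction k with
  | zero =>
    have : ∀ y ∈ Finset.range (x + 1 + 0), (if x < y then P else 1) *
      (X ^ geC s y - X ^ geC s (y + 1) : ℤ[X]) = X ^ geC s y - X ^ geC s (y + 1) := by
      intro y hy
      have := Finset.mem_range.1 hy
      rw [if_neg (by omega), one_mul]
    rw [Finset.sum_congr rfl this, Finset.sum_range_sub' (fun y => (X ^ geC s y : ℤ[X]))]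
    simp [geC_zero]
  | succ k ih =>
    rw [← add_assoc, Finset.sum_range_succ, ih, if_pos (by omega)]; ring

theorem key (s : Multiset ℕ) (x N : ℕ) (hx : x < N) (hN : ∀ y ∈ s, y < N) :
    ∑ y ∈ s.toFinset, (if x < y then X ^ s.card else 1) *
      (X ^ geC s (y + 1) * qn (s.count y)) = X ^ geC s (x + 1) * qn s.card := by
  have hne : (X - 1 : ℤ[X]) ≠ 0 := X_sub_C_ne_zero (1 : ℤ)
  apply mul_right_cancel₀ hne
  rw [mul_assoc, qn_mul, Finset.sum_mul]
  simp only [mul_assoc, qn_mul]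
  obtain ⟨k, rfl⟩ := Nat.exists_eq_add_of_le (Nat.succ_le_of_lt hx)
  have := key_aux s x (X ^ s.card) k
  rw [Finset.sum_subset (s₂ := Finset.range (x + 1 + k)), this, geC_top s _ hN]
  · ring
  · intro y hy; exact Finset.mem_range.2 (hN y (Multiset.mem_toFinset.1 hy))
  · intro y _ hy
    rw [Multiset.count_eq_zero_of_notMem (by simpa using hy)]; simp

theorem key0 (s : Multiset ℕ) (N : ℕ) (hN : ∀ y ∈ s, y < N) :
    ∑ y ∈ s.toFinset, (X ^ geC s (y + 1) * qn (s.count y)) = qn s.card := by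
  have := key s N (N + 1) (by omega) (fun y hy => (hN y hy).trans (by omega))
  rw [geC_top s (N + 1) (fun y hy => (hN y hy).trans (by omega)), pow_zero, one_mul] at this
  rw [← this]
  refine Finset.sum_congr rfl fun y hy => ?_
  have := hN y (Multiset.mem_toFinset.1 hy)
  rw [if_neg (by omega), one_mul]

/-- all words with content `s` -/
def LL (s : Multiset ℕ) : Finset (List ℕ) := s.lists.toFinset

theorem mem_LL {s : Multiset ℕ} {l : List ℕ} : l ∈ LL s ↔ s = (l : Multiset ℕ) := by
  rw [LL, Multiset.mem_toFinset, Multiset.mem_lists_iff]; rfl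

theorem sum_lists (s : Multiset ℕ) (hs : s ≠ 0) (f : List ℕ → ℤ[X]) :
    ∑ l ∈ LL s, f l = ∑ x ∈ s.toFinset, ∑ l ∈ LL (s.erase x), f (x :: l) := by
  have : LL s = s.toFinset.biUnion (fun x => (LL (s.erase x)).image (List.cons x)) := by
    ext l
    simp only [mem_LL, Finset.mem_biUnion, Finset.mem_image, Multiset.mem_toFinset]
    constructor
    · rintro rfl
      cases l with
      | nil => simp at hs
      | cons x l => exact ⟨x, by simp, l, by simp, rfl⟩
    · rintro ⟨x, hx, l, hl, rfl⟩
      rw [← Multiset.cons_coe, ← hl, Multiset.cons_erase hx]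
  rw [this, Finset.sum_biUnion]
  · refine Finset.sum_congr rfl fun x _ => ?_
    rw [Finset.sum_image]
    intro a _ b _ h; exact (List.cons.inj h).2
  · intro x _ y _ hxy
    rw [Function.onFun, Finset.disjoint_left]
    intro l h1 h2
    obtain ⟨a, _, rfl⟩ := Finset.mem_image.1 h1
    obtain ⟨b, _, h⟩ := Finset.mem_image.1 h2
    exact hxy (List.cons.inj h).1.symm

noncomputable def II (s : Multiset ℕ) : ℤ[X] := ∑ l ∈ LL s, X ^ invL l

theorem invL_cons (s : Multiset ℕ) (x : ℕ) (l : List ℕ) (hl : l ∈ LL s) :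
    invL (x :: l) = invL l + geC s (x + 1) := by
  rw [mem_LL] at hl
  subst hl
  simp only [invL, geC, Multiset.coe_countP, Nat.succ_le_iff]

theorem II_rec (s : Multiset ℕ) (hs : s ≠ 0) :
    II s = ∑ x ∈ s.toFinset, X ^ geC s (x + 1) * II (s.erase x) := by
  rw [II, sum_lists s hs]
  refine Finset.sum_congr rfl fun x _ => ?_
  rw [II, Finset.mul_sum]
  refine Finset.sum_congr rfl fun l hl => ?_
  rw [invL_cons _ x l hl, geC_erase, pow_add, mul_comm]

theorem lists_zero : LL 0 = {[]} := by
  ext l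
  rw [mem_LL, Finset.mem_singleton, eq_comm, Multiset.coe_eq_zero]

theorem II_zero : II 0 = 1 := by simp [II, lists_zero, invL]

theorem II_prod (N m : ℕ) : ∀ s : Multiset ℕ, s.card = m → (∀ y ∈ s, y < N) →
    II s * DD N s = qf m := by
  induction m with
  | zero =>
    intro s hs _
    rw [Multiset.card_eq_zero] at hs
    subst hs
    simp [II_zero, DD, qf]
  | succ m ih =>
    intro s hs hN
    have h0 : s ≠ 0 := by rintro rfl; simp at hs
    rw [II_rec s h0, Finset.sum_mul, qf_succ, ← hs, ← key0 s N hN, Finset.sum_mul]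
    refine Finset.sum_congr rfl fun x hx => ?_
    rw [Multiset.mem_toFinset] at hx
    rw [DD_erase N s x (hN x hx) hx, ← ih (s.erase x) (by rw [Multiset.card_erase_of_mem hx, hs]; rfl)
      (fun y hy => hN y (Multiset.mem_of_mem_erase hy))]
    ring

theorem maj_last (m : ℕ) : ∀ (s : Multiset ℕ) (x : ℕ), s.card = m →
    ∑ l ∈ LL s, X ^ majL (x :: l) = X ^ geC s (x + 1) * II s := by
  induction m with
  | zero =>
    intro s x hs
    rw [Multiset.card_eq_zero] at hs
    subst hs
    simp [lists_zero, majL, topL, geC, II_zero]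
  | succ m ih =>
    intro s x hs
    have h0 : s ≠ 0 := by rintro rfl; simp at hs
    obtain ⟨N, hx, hN⟩ : ∃ N, x < N ∧ ∀ y ∈ s, y < N := by
      refine ⟨x + s.sum + 1, by omega, fun y hy => ?_⟩
      have := Multiset.le_sum_of_mem hy
      omega
    have hce : ∀ y ∈ s, (s.erase y).card = m := fun y hy => by
      rw [Multiset.card_erase_of_mem hy, hs]; rfl
    apply mul_right_cancel₀ (DD_ne N s)
    rw [mul_assoc, II_prod N (m + 1) s hs hN, qf_succ, ← hs, ← mul_assoc, ← key s x N hx hN,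
      sum_lists s h0, Finset.sum_mul, Finset.sum_mul]
    refine Finset.sum_congr rfl fun y hy => ?_
    rw [Multiset.mem_toFinset] at hy
    have h1 : ∑ l ∈ LL (s.erase y), (X ^ majL (x :: y :: l) : ℤ[X]) =
        (if x < y then X ^ s.card else 1) * (X ^ geC s (y + 1) * II (s.erase y)) := by
      rw [← geC_erase, ← ih _ y (hce y hy), Finset.mul_sum]
      refine Finset.sum_congr rfl fun l hl => ?_
      rw [mem_LL] at hl
      have hlen : (y :: l).length = s.card := by
        rw [List.length_cons, hs, ← hce y hy, hl, Multiset.coe_card]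
      rw [majL, topL, hlen, pow_add, mul_comm]
      split_ifs <;> simp
    rw [h1, DD_erase N s y (hN y hy) hy, ← II_prod N m (s.erase y) (hce y hy)
      (fun z hz => hN z (Multiset.mem_of_mem_erase hz))]
    ring

theorem macmahon (s : Multiset ℕ) :
    ∑ l ∈ LL s, (X ^ invL l : ℤ[X]) = ∑ l ∈ LL s, X ^ majL l := by
  by_cases h : s = 0
  · subst h; simp [lists_zero, invL, majL]
  · change II s = _
    rw [II_rec s h, sum_lists s h]
    refine Finset.sum_congr rfl fun x _ => ?_
    rw [maj_last _ _ x rfl, geC_erase]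

theorem countP_ofFn_lt : ∀ (n a : ℕ) (g : Fin n → ℕ),
    List.countP (fun y => decide (a < y)) (List.ofFn g) = ∑ i : Fin n, if a < g i then 1 else 0
  | 0, a, g => by simp
  | n + 1, a, g => by
    rw [List.ofFn_succ, List.countP_cons, countP_ofFn_lt n a, Fin.sum_univ_succ, add_comm]
    simp

theorem invL_ofFn : ∀ (n : ℕ) (f : Fin n → ℕ), inv f = invL (List.ofFn f).reverse
  | 0, f => by simp [inv, invL]
  | n + 1, f => by
    rw [List.ofFn_succ', List.concat_eq_append, List.reverse_append, List.reverse_singleton,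
      List.singleton_append, invL, ← invL_ofFn n (fun i => f i.castSucc), List.countP_reverse]
    have h : List.countP (fun y => decide (f (Fin.last n) < y)) (List.ofFn fun i => f i.castSucc) =
        ∑ i : Fin n, if f (Fin.last n) < f i.castSucc then 1 else 0 := by
      exact countP_ofFn_lt n _ _
    rw [h]
    simp only [inv, Finset.card_filter, Fintype.sum_prod_type, Fin.sum_univ_castSucc]
    simp [Fin.castSucc_lt_last, Finset.sum_add_distrib, Fin.le_last, not_lt.2]

theorem majL_ofFn : ∀ (n : ℕ) (f : Fin n → ℕ), maj f = majL (List.ofFn f).reverse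
  | 0, f => by simp [maj, majL]
  | n + 1, f => by
    rw [List.ofFn_succ', List.concat_eq_append, List.reverse_append, List.reverse_singleton,
      List.singleton_append, majL, ← majL_ofFn n (fun i => f i.castSucc)]
    have h : topL (f (Fin.last n)) (List.ofFn fun i => f i.castSucc).reverse =
        ∑ i : Fin n, if n = (i : ℕ) + 1 ∧ f (Fin.last n) < f i.castSucc then (i : ℕ) + 1 else 0 := by
      cases n with
      | zero => simp [topL]
      | succ n =>
        rw [List.ofFn_succ', List.concat_eq_append, List.reverse_append, List.reverse_singleton,
          List.singleton_append, topL, Fin.sum_univ_castSucc, Finset.sum_eq_zero]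
        · simp
        · intro i _
          have := i.2
          rw [if_neg]
          simp only [Fin.val_castSucc]
          omega
    rw [h]
    simp only [maj, Finset.sum_filter, Fintype.sum_prod_type, Fin.sum_univ_castSucc]
    have h1 : ∀ i : Fin n, (i : ℕ) ≠ n + 1 := fun i => by have := i.2; omega
    simp [Finset.sum_add_distrib, h1]

/-- block number of a position -/
def blk (n : ℕ) (S : Finset ℕ) (i : Fin n) : ℕ := (S.filter (fun s => s ≤ (i : ℕ))).card

theorem blk_mono (n : ℕ) (S : Finset ℕ) : Monotone (blk n S) := by
  intro i j h
  apply Finset.card_le_card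
  intro s hs
  rw [Finset.mem_filter] at hs ⊢
  exact ⟨hs.1, hs.2.trans h⟩

theorem mem_DesSet {n : ℕ} (π : Equiv.Perm (Fin n)) (k : ℕ) :
    k ∈ DesSet π ↔ ∃ i j : Fin n, (j : ℕ) = i + 1 ∧ π j < π i ∧ (i : ℕ) + 1 = k := by
  simp [DesSet, and_assoc]

theorem des_sub_iff {n : ℕ} (S : Finset ℕ) (π : Equiv.Perm (Fin n)) :
    DesSet π ⊆ S ↔ ∀ i j, i < j → blk n S i = blk n S j → π i < π j := by
  constructor
  · intro h
    have key : ∀ (k : ℕ) (i j : Fin n), (j : ℕ) = i + (k + 1) → blk n S i = blk n S j → π i < π j := by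
      intro k
      induction k with
      | zero =>
        intro i j hij hb
        by_contra hc
        have hlt : π j < π i := by
          refine lt_of_le_of_ne (not_lt.1 hc) fun e => ?_
          have := congrArg Fin.val (π.injective e)
          omega
        have hS := h ((mem_DesSet π (i + 1)).2 ⟨i, j, by omega, hlt, rfl⟩)
        have : blk n S i < blk n S j := by
          apply Finset.card_lt_card
          rw [Finset.ssubset_iff_of_subset]
          · exact ⟨i + 1, Finset.mem_filter.2 ⟨hS, by omega⟩, by simp⟩
          · intro s hs
            rw [Finset.mem_filter] at hs ⊢
            exact ⟨hs.1, by omega⟩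
        omega
      | succ k ih =>
        intro i j hij hb
        let m : Fin n := ⟨i + (k + 1), by omega⟩
        have h1 : blk n S i ≤ blk n S m := blk_mono n S (by rw [Fin.le_def]; simp [m])
        have h2 : blk n S m ≤ blk n S j := blk_mono n S (by rw [Fin.le_def]; simp only [m]; omega)
        refine (ih i m rfl (by omega)).trans ?_
        by_contra hc
        have hlt : π j < π m := by
          refine lt_of_le_of_ne (not_lt.1 hc) fun e => ?_
          have := congrArg Fin.val (π.injective e)
          simp only [m] at this
          omega
        have hS := h ((mem_DesSet π (m + 1)).2 ⟨m, j, by simp only [m]; omega, hlt, rfl⟩)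
        have : blk n S m < blk n S j := by
          apply Finset.card_lt_card
          rw [Finset.ssubset_iff_of_subset]
          · exact ⟨m + 1, Finset.mem_filter.2 ⟨hS, by simp only [m]; omega⟩, by simp⟩
          · intro s hs
            rw [Finset.mem_filter] at hs ⊢
            exact ⟨hs.1, by have := hs.2; simp only [m] at this; omega⟩
        omega
    intro i j hij
    exact key (j - i - 1) i j (by rw [Fin.lt_def] at hij; omega)
  · intro h k hk
    obtain ⟨i, j, hij, hlt, rfl⟩ := (mem_DesSet π k).1 hk
    by_contra hc
    refine absurd (h i j (by rw [Fin.lt_def]; omega) ?_) (not_lt.2 hlt.le)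
    unfold blk
    congr 1
    refine Finset.filter_congr fun s hs => ?_
    have : s ≠ i + 1 := by rintro rfl; exact hc hs
    omega

theorem inv_eq_word {n : ℕ} (S : Finset ℕ) (π : Equiv.Perm (Fin n)) (h : DesSet π ⊆ S) :
    inv (fun i => (π i : ℕ)) = inv (blk n S ∘ π.symm) := by
  rw [des_sub_iff] at h
  unfold inv
  refine Finset.card_bij' (fun p _ => (π p.2, π p.1)) (fun p _ => (π.symm p.2, π.symm p.1))
    ?_ ?_ ?_ ?_
  · rintro ⟨i, j⟩ hp
    simp only [Finset.mem_filter, Finset.mem_univ, true_and, Fin.val_fin_lt] at hp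
    simp only [Finset.mem_filter, Finset.mem_univ, true_and, Function.comp, Equiv.symm_apply_apply]
    refine ⟨hp.2, lt_of_le_of_ne (blk_mono n S hp.1.le) fun e => ?_⟩
    exact absurd (h i j hp.1 e) (not_lt.2 hp.2.le)
  · rintro ⟨k, l⟩ hp
    simp only [Finset.mem_filter, Finset.mem_univ, true_and, Function.comp] at hp
    simp only [Finset.mem_filter, Finset.mem_univ, true_and, Equiv.apply_symm_apply, Fin.val_fin_lt]
    exact ⟨(blk_mono n S).reflect_lt hp.2, hp.1⟩
  · rintro ⟨i, j⟩ _; simp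
  · rintro ⟨i, j⟩ _; simp

theorem maj_eq_word {n : ℕ} (S : Finset ℕ) (π : Equiv.Perm (Fin n)) (h : DesSet π ⊆ S) :
    maj (fun i => (π.symm i : ℕ)) = maj (blk n S ∘ π.symm) := by
  rw [des_sub_iff] at h
  unfold maj
  refine Finset.sum_congr (Finset.filter_congr ?_) fun _ _ => rfl
  rintro ⟨k, l⟩ _
  simp only [Function.comp, Fin.val_fin_lt]
  refine and_congr_right fun hkl => ⟨fun hlt => ?_, fun hlt => (blk_mono n S).reflect_lt hlt⟩
  refine lt_of_le_of_ne (blk_mono n S hlt.le) fun e => ?_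
  have := h _ _ hlt e
  simp only [Equiv.apply_symm_apply, Fin.lt_def] at this
  omega

theorem sum_words (n : ℕ) (S : Finset ℕ) (F : List ℕ → ℤ[X]) :
    ∑ π ∈ Finset.univ.filter (fun π : Equiv.Perm (Fin n) => DesSet π ⊆ S),
      F (List.ofFn (blk n S ∘ π.symm)).reverse =
    ∑ l ∈ LL (List.ofFn (blk n S) : Multiset ℕ), F l := by
  have hsort : ∀ π : Equiv.Perm (Fin n), DesSet π ⊆ S → π = Tuple.sort (blk n S ∘ π.symm) := by
    intro π h
    rw [des_sub_iff] at h
    rw [Tuple.eq_sort_iff]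
    refine ⟨?_, ?_⟩
    · have : (blk n S ∘ π.symm) ∘ π = blk n S := by ext i; simp
      rw [this]; exact blk_mono n S
    · intro i j hij e
      simp only [Function.comp, Equiv.symm_apply_apply] at e
      exact h i j hij e
  refine Finset.sum_bij (fun π _ => (List.ofFn (blk n S ∘ π.symm)).reverse) ?_ ?_ ?_ ?_
  · intro π _
    rw [mem_LL, Multiset.coe_eq_coe]
    exact ((List.reverse_perm _).trans (Equiv.Perm.ofFn_comp_perm π.symm (blk n S))).symm
  · intro π hπ τ hτ e
    have e' := List.ofFn_injective (List.reverse_injective e)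
    rw [hsort π (Finset.mem_filter.1 hπ).2, hsort τ (Finset.mem_filter.1 hτ).2, e']
  · intro l hl
    rw [mem_LL, Multiset.coe_eq_coe] at hl
    have hp : (List.ofFn (blk n S)).Perm l.reverse := hl.trans (List.reverse_perm l).symm
    have hlen : l.reverse.length = n := by rw [← hp.length_eq, List.length_ofFn]
    obtain ⟨w, hw⟩ : ∃ w : Fin n → ℕ, List.ofFn w = l.reverse := by
      generalize l.reverse = r at hlen
      subst hlen
      exact ⟨r.get, List.ofFn_get r⟩
    rw [← hw] at hp
    have hb : w ∘ Tuple.sort w = blk n S := List.ofFn_injective <|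
      ((Equiv.Perm.ofFn_comp_perm (Tuple.sort w) w).trans hp.symm).eq_of_pairwise'
        (Tuple.monotone_sort w).sortedLE_ofFn.pairwise (blk_mono n S).sortedLE_ofFn.pairwise
    have hw' : blk n S ∘ (Tuple.sort w).symm = w := by rw [← hb]; ext i; simp
    refine ⟨Tuple.sort w, ?_, ?_⟩
    · rw [Finset.mem_filter, des_sub_iff]
      refine ⟨Finset.mem_univ _, fun i j hij e => ?_⟩
      rw [← hb] at e
      exact (Tuple.eq_sort_iff.1 rfl : Monotone (w ∘ Tuple.sort w) ∧ _).2 i j hij e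
    · rw [hw', hw, List.reverse_reverse]
  · intro π _; rfl

theorem sub_eq (n : ℕ) (S : Finset ℕ) :
    ∑ π ∈ Finset.univ.filter (fun π : Equiv.Perm (Fin n) => DesSet π ⊆ S),
      (X : Polynomial ℤ) ^ inv (fun i => (π i : ℕ)) =
    ∑ π ∈ Finset.univ.filter (fun π : Equiv.Perm (Fin n) => DesSet π ⊆ S),
      (X : Polynomial ℤ) ^ maj (fun i => (π.symm i : ℕ)) := by
  have h := macmahon (List.ofFn (blk n S) : Multiset ℕ)
  rw [← sum_words n S (fun l => X ^ invL l), ← sum_words n S (fun l => X ^ majL l)] at h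
  simp only [← invL_ofFn, ← majL_ofFn] at h
  convert h using 1
  · refine Finset.sum_congr rfl fun π hπ => ?_
    rw [inv_eq_word S π (Finset.mem_filter.1 hπ).2]
  · refine Finset.sum_congr rfl fun π hπ => ?_
    rw [maj_eq_word S π (Finset.mem_filter.1 hπ).2]

theorem sum_split (n : ℕ) (S : Finset ℕ) (f : Equiv.Perm (Fin n) → ℤ[X]) :
    ∑ π ∈ Finset.univ.filter (fun π : Equiv.Perm (Fin n) => DesSet π ⊆ S), f π =
    (∑ π ∈ Finset.univ.filter (fun π : Equiv.Perm (Fin n) => DesSet π = S), f π) +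
    ∑ T ∈ S.ssubsets, ∑ π ∈ Finset.univ.filter (fun π : Equiv.Perm (Fin n) => DesSet π = T), f π := by
  rw [Finset.ssubsets, Finset.add_sum_erase S.powerset
    (fun T => ∑ π ∈ Finset.univ.filter (fun π : Equiv.Perm (Fin n) => DesSet π = T), f π)
    (Finset.mem_powerset_self S)]
  rw [← Finset.sum_fiberwise_of_maps_to (t := S.powerset) (g := fun π => DesSet π)]
  · refine Finset.sum_congr rfl fun T hT => Finset.sum_congr ?_ fun _ _ => rfl
    ext π
    simp only [Finset.mem_filter, Finset.mem_univ, true_and, and_iff_right_iff_imp]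
    rintro rfl; exact Finset.mem_powerset.1 hT
  · intro π hπ
    exact Finset.mem_powerset.2 (Finset.mem_filter.1 hπ).2

theorem main_all (n : ℕ) (S : Finset ℕ) :
    ∑ π ∈ Finset.univ.filter (fun π : Equiv.Perm (Fin n) => DesSet π = S),
      (X : Polynomial ℤ) ^ inv (fun i => (π i : ℕ)) =
    ∑ π ∈ Finset.univ.filter (fun π : Equiv.Perm (Fin n) => DesSet π = S),
      (X : Polynomial ℤ) ^ maj (fun i => (π.symm i : ℕ)) := by
  induction S using Finset.strongInduction with
  | H S ih =>
    have h := sub_eq n S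
    rw [sum_split, sum_split,
      Finset.sum_congr rfl fun T hT => ih T (Finset.mem_ssubsets.1 hT)] at h
    exact add_right_cancel h

/-- for any `S ⊆ [n−1]`, `inv` and `imaj` are equidistributed on
`{π ∈ S_n : Des(π) = S}`. -/
theorem inv_imaj_equidistributed_des_eq (n : ℕ) (S : Finset ℕ)
    (hS : ∀ x ∈ S, 1 ≤ x ∧ x ≤ n - 1) :
    ∑ π ∈ Finset.univ.filter (fun π : Equiv.Perm (Fin n) => DesSet π = S),
      (X : Polynomial ℤ) ^ inv (fun i => (π i : ℕ)) =
    ∑ π ∈ Finset.univ.filter (fun π : Equiv.Perm (Fin n) => DesSet π = S),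
      (X : Polynomial ℤ) ^ maj (fun i => (π.symm i : ℕ)) := by
  exact main_all n S
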